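/- arXiv:2104.12932 — 5 statements merged into one kernel-verified Lean document; each statement's English description precedes it below -/
import Mathlib

section
/- Let A and B be linear endomorphisms of the real vector space ℝ⁴ satisfying A² = 0, B² = 0 and (A + B)² = 0 (equivalently A∘B + B∘A = 0). If the kernel of A has dimension 3, then A∘B = 0 and B∘A = 0; in particular A and B commute. -/
/-- Square-zero anticommuting endomorphisms of `ℝ⁴`: if `ker A` has dimension 3 then
`A∘B = 0` and `B∘A = 0`, in particular `A` and `B` commute. -/
theorem squareZero_anticommute_kerdim_three
    (A B : Module.End ℝ (Fin 4 → ℝ))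
    (hA : A ^ 2 = 0) (hB : B ^ 2 = 0) (hAB : (A + B) ^ 2 = 0)
    (hker : Module.finrank ℝ (LinearMap.ker A) = 3) :
    A * B = 0 ∧ B * A = 0 ∧ A * B = B * A := by
  have hanti : A * B + B * A = 0 := by
    have h : (A + B) ^ 2 = A ^ 2 + (A * B + B * A) + B ^ 2 := by noncomm_ring
    rw [hAB, hA, hB] at h
    simpa using h.symm
  have hr : Module.finrank ℝ (LinearMap.range A) = 1 := by
    have h := LinearMap.finrank_range_add_finrank_ker A
    rw [hker, Module.finrank_fin_fun] at h
    omega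
  obtain ⟨⟨v, w, hw⟩, hv0, hv⟩ := finrank_eq_one_iff'.1 hr
  have hspan : ∀ x, ∃ c : ℝ, c • v = A x := fun x => by
    obtain ⟨c, hc⟩ := hv ⟨A x, x, rfl⟩
    exact ⟨c, congrArg Subtype.val hc⟩
  have hv0' : v ≠ 0 := fun h => hv0 (Subtype.ext h)
  have hBv : B v = 0 := by
    obtain ⟨c, hc⟩ := hspan (B w)
    have h1 : A (B w) + B (A w) = 0 := LinearMap.congr_fun hanti w
    rw [← hc, hw] at h1
    have h2 : B v = (-c) • v := by
      rw [neg_smul]; exact eq_neg_of_add_eq_zero_right h1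
    have h3 : B (B v) = 0 := by
      have := LinearMap.congr_fun hB v
      rwa [pow_two] at this
    rw [h2, map_smul, h2, smul_smul] at h3
    have h4 : c = 0 := by
      rcases smul_eq_zero.1 h3 with h | h
      · simpa using h
      · exact absurd h hv0'
    rw [h2, h4]; simp
  have hBA : B * A = 0 := by
    refine LinearMap.ext fun x => ?_
    obtain ⟨c, hc⟩ := hspan x
    change B (A x) = 0
    rw [← hc, map_smul, hBv, smul_zero]
  have hAB0 : A * B = 0 := by
    rw [hBA, add_zero] at hanti
    exact hanti
  exact ⟨hAB0, hBA, hAB0.trans hBA.symm⟩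
end

section
/- Let A and B be linear endomorphisms of the real vector space ℝ⁴ satisfying A² = 0, B² = 0 and (A + B)² = 0, with dim(ker A) = dim(ker B) = 2. If either ker A ∩ ker B = {0} or ker A = ker B, then A∘B = 0 and B∘A = 0. -/
/-- Square-zero anticommuting endomorphisms of `ℝ⁴` with two-dimensional kernels:
if the kernels either intersect trivially or coincide, then `A∘B = 0` and `B∘A = 0`. -/
theorem squareZero_anticommute_kerdim_two
    (A B : Module.End ℝ (Fin 4 → ℝ))
    (hA : A ^ 2 = 0) (hB : B ^ 2 = 0) (hAB : (A + B) ^ 2 = 0)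
    (hkerA : Module.finrank ℝ (LinearMap.ker A) = 2)
    (hkerB : Module.finrank ℝ (LinearMap.ker B) = 2)
    (hcase : LinearMap.ker A ⊓ LinearMap.ker B = ⊥ ∨ LinearMap.ker A = LinearMap.ker B) :
    A * B = 0 ∧ B * A = 0 := by
  have hsum : A * B + B * A = 0 := by
    have h : (A + B) ^ 2 = A ^ 2 + B ^ 2 + (A * B + B * A) := by noncomm_ring
    rw [hAB, hA, hB] at h
    simpa using h.symm
  have hA' : ∀ x, A (A x) = 0 := fun x => by
    have := LinearMap.congr_fun hA x
    simpa [pow_two] using this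
  have hB' : ∀ x, B (B x) = 0 := fun x => by
    have := LinearMap.congr_fun hB x
    simpa [pow_two] using this
  have hs : ∀ x, A (B x) = - B (A x) := fun x => by
    have := LinearMap.congr_fun hsum x
    exact eq_neg_of_add_eq_zero_left this
  have key : A * B = 0 := by
    apply LinearMap.ext
    intro x
    change A (B x) = 0
    rcases hcase with h | h
    · have hm : A (B x) ∈ LinearMap.ker A ⊓ LinearMap.ker B := by
        refine ⟨hA' _, ?_⟩
        rw [SetLike.mem_coe, LinearMap.mem_ker, hs, map_neg, hB', neg_zero]
      rw [h] at hm
      simpa using hm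
    · have hm : B x ∈ LinearMap.ker B := hB' x
      rw [← h] at hm
      exact hm
  refine ⟨key, ?_⟩
  rw [key, zero_add] at hsum
  exact hsum
end

section
/- Let A and B be linear endomorphisms of the real vector space ℝ⁴ satisfying A² = 0, B² = 0 and (A + B)² = 0, and suppose A∘B ≠ B∘A. Then dim(ker A) = dim(ker B) = 2, dim(ker A ∩ ker B) = 1, and dim(ker A + ker B) = 3. Consequently every linear automorphism g of ℝ⁴ commuting with both A and B preserves each of the three subspaces ker A ∩ ker B, ker A, and ker A + ker B, i.e. preserves a complete flag of subspaces of dimensions 1, 2, 3. -/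
theorem aux_pair (K : Submodule ℝ (Fin 4 → ℝ)) (x y : Fin 4 → ℝ) (hx : x ∈ K) (hy : y ∈ K)
    (h : ∀ z ∈ K, ∃ s t : ℝ, z = s • x + t • y)
    (hi : ∀ s t : ℝ, s • x + t • y = 0 → s = 0 ∧ t = 0) : Module.finrank ℝ K = 2 := by
  have hK : K = Submodule.span ℝ (Set.range ![x, y]) := by
    apply le_antisymm
    · intro z hz
      obtain ⟨s, t, rfl⟩ := h z hz
      exact add_mem (Submodule.smul_mem _ _ (Submodule.subset_span ⟨0, rfl⟩))
        (Submodule.smul_mem _ _ (Submodule.subset_span ⟨1, rfl⟩))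
    · rw [Submodule.span_le]
      rintro _ ⟨i, rfl⟩
      fin_cases i
      · exact hx
      · exact hy
  have hl : LinearIndependent ℝ ![x, y] := LinearIndependent.pair_iff.2 hi
  rw [hK, finrank_span_eq_card hl]
  simp

/-- Noncommuting square-zero anticommuting endomorphisms of `ℝ⁴` determine a complete
flag preserved by any automorphism commuting with both of them. -/
theorem squareZero_anticommute_noncommuting_flag
    (A B : Module.End ℝ (Fin 4 → ℝ))
    (hA : A ^ 2 = 0) (hB : B ^ 2 = 0) (hAB : (A + B) ^ 2 = 0)
    (hnc : A * B ≠ B * A) :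
    Module.finrank ℝ (LinearMap.ker A) = 2 ∧
    Module.finrank ℝ (LinearMap.ker B) = 2 ∧
    Module.finrank ℝ (LinearMap.ker A ⊓ LinearMap.ker B : Submodule ℝ (Fin 4 → ℝ)) = 1 ∧
    Module.finrank ℝ (LinearMap.ker A ⊔ LinearMap.ker B : Submodule ℝ (Fin 4 → ℝ)) = 3 ∧
    ∀ g : (Fin 4 → ℝ) ≃ₗ[ℝ] (Fin 4 → ℝ),
      (g : Module.End ℝ (Fin 4 → ℝ)) * A = A * (g : Module.End ℝ (Fin 4 → ℝ)) →
      (g : Module.End ℝ (Fin 4 → ℝ)) * B = B * (g : Module.End ℝ (Fin 4 → ℝ)) →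
      ((∀ x ∈ LinearMap.ker A ⊓ LinearMap.ker B, g x ∈ LinearMap.ker A ⊓ LinearMap.ker B) ∧
       (∀ x ∈ LinearMap.ker A, g x ∈ LinearMap.ker A) ∧
       (∀ x ∈ LinearMap.ker A ⊔ LinearMap.ker B, g x ∈ LinearMap.ker A ⊔ LinearMap.ker B)) := by
  have hA' : ∀ x, A (A x) = 0 := fun x => by
    simpa [pow_two] using LinearMap.congr_fun hA x
  have hB' : ∀ x, B (B x) = 0 := fun x => by
    simpa [pow_two] using LinearMap.congr_fun hB x
  have hBA : ∀ x, B (A x) = - A (B x) := fun x => by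
    have := LinearMap.congr_fun hAB x
    simp [pow_two, hA', hB'] at this
    exact eq_neg_of_add_eq_zero_left (by simpa [add_comm] using this)
  obtain ⟨v, hv⟩ : ∃ v, A (B v) ≠ 0 := by
    by_contra! h
    apply hnc
    apply LinearMap.ext
    intro x
    simp [hBA, h]
  have hAAB := hA' (B v)
  have hBAB : B (A (B v)) = 0 := by rw [hBA, hB']; simp
  have li : ∀ a b c d : ℝ, a • v + b • A v + c • B v + d • A (B v) = 0 →
      a = 0 ∧ b = 0 ∧ c = 0 ∧ d = 0 := by
    intro a b c d h
    have ha : a = 0 := by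
      have := congrArg (fun x => A (B x)) h
      simpa [hA', hB', hBA, hv] using this
    subst ha
    have hb : b = 0 := by
      have := congrArg B h
      simpa [hA', hB', hBA, hv] using this
    have hc : c = 0 := by
      have := congrArg A h
      simpa [hA', hB', hBA, hv] using this
    subst hb hc
    simpa [hv] using h
  have hl : LinearIndependent ℝ ![v, A v, B v, A (B v)] := by
    rw [Fintype.linearIndependent_iff]
    intro g hg
    obtain ⟨h0, h1, h2, h3⟩ := li (g 0) (g 1) (g 2) (g 3) (by simpa [Fin.sum_univ_four] using hg)
    intro i
    fin_cases i <;> assumption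
  have sp : ∀ x, ∃ a b c d : ℝ, x = a • v + b • A v + c • B v + d • A (B v) := by
    intro x
    have ht := hl.span_eq_top_of_card_eq_finrank' (by simp)
    have hx : x ∈ Submodule.span ℝ (Set.range ![v, A v, B v, A (B v)]) := ht ▸ Submodule.mem_top
    obtain ⟨c, hc⟩ := (Submodule.mem_span_range_iff_exists_fun ℝ).1 hx
    exact ⟨c 0, c 1, c 2, c 3, by rw [← hc]; simp [Fin.sum_univ_four]⟩
  have kA : ∀ x, A x = 0 → ∃ s t : ℝ, x = s • A v + t • A (B v) := by
    intro x hx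
    obtain ⟨a, b, c, d, rfl⟩ := sp x
    obtain ⟨-, h1, -, h2⟩ := li 0 a 0 c (by simpa [hA'] using hx)
    exact ⟨b, d, by simp [h1, h2]⟩
  have kB : ∀ x, B x = 0 → ∃ s t : ℝ, x = s • B v + t • A (B v) := by
    intro x hx
    obtain ⟨a, b, c, d, rfl⟩ := sp x
    obtain ⟨-, -, h1, h2⟩ := li 0 0 a (-b) (by simpa [hB', hBA] using hx)
    exact ⟨c, d, by simp [h1, neg_eq_zero.1 h2]⟩
  have dA : Module.finrank ℝ (LinearMap.ker A) = 2 :=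
    aux_pair _ (A v) (A (B v)) (hA' v) hAAB kA fun s t h => by
      obtain ⟨-, h1, -, h2⟩ := li 0 s 0 t (by simpa using h)
      exact ⟨h1, h2⟩
  have dB : Module.finrank ℝ (LinearMap.ker B) = 2 :=
    aux_pair _ (B v) (A (B v)) (hB' v) hBAB kB fun s t h => by
      obtain ⟨-, -, h1, h2⟩ := li 0 0 s t (by simpa using h)
      exact ⟨h1, h2⟩
  have dI : Module.finrank ℝ
      (LinearMap.ker A ⊓ LinearMap.ker B : Submodule ℝ (Fin 4 → ℝ)) = 1 := by
    have : LinearMap.ker A ⊓ LinearMap.ker B = Submodule.span ℝ {A (B v)} := by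
      apply le_antisymm
      · rintro x ⟨h1, h2⟩
        obtain ⟨s, t, rfl⟩ := kA x h1
        have h2' : B (s • A v + t • A (B v)) = 0 := h2
        have hs : s = 0 := by simpa [hBA, hB', hv] using h2'
        rw [Submodule.mem_span_singleton]
        exact ⟨t, by simp [hs]⟩
      · rw [Submodule.span_singleton_le_iff_mem]
        exact ⟨hAAB, hBAB⟩
    rw [this, finrank_span_singleton hv]
  refine ⟨dA, dB, dI, ?_, ?_⟩
  · have := Submodule.finrank_sup_add_finrank_inf_eq (LinearMap.ker A) (LinearMap.ker B)
    omega
  · intro g gA gB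
    have pA : ∀ x ∈ LinearMap.ker A, g x ∈ LinearMap.ker A := fun x hx => by
      have h := LinearMap.congr_fun gA x
      have hx' : A x = 0 := hx
      simp [hx'] at h
      exact h.symm
    have pB : ∀ x ∈ LinearMap.ker B, g x ∈ LinearMap.ker B := fun x hx => by
      have h := LinearMap.congr_fun gB x
      have hx' : B x = 0 := hx
      simp [hx'] at h
      exact h.symm
    refine ⟨fun x hx => ⟨pA x hx.1, pB x hx.2⟩, pA, fun x hx => ?_⟩
    obtain ⟨y, hy, z, hz, rfl⟩ := Submodule.mem_sup.1 hx
    rw [map_add]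
    exact Submodule.add_mem_sup (pA y hy) (pB z hz)
end

section
/- Let A be a nilpotent linear endomorphism of the real vector space ℝ⁴ with A² ≠ 0 and dim(ker A) = 2. Then dim(im A) = 2, ker A ≠ im A, dim(ker A ∩ im A) = 1 and dim(ker A + im A) = 3. Consequently every linear automorphism of ℝ⁴ commuting with A preserves each of the subspaces ker A ∩ im A, ker A, and ker A + im A, i.e. preserves a complete flag of subspaces of dimensions 1, 2, 3. -/
/-- A nilpotent endomorphism of `ℝ⁴` with `A² ≠ 0` and two-dimensional kernel yields a
complete flag `ker A ∩ im A ⊂ ker A ⊂ ker A + im A` preserved by any automorphism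
commuting with `A`. -/
theorem nilpotent_kerdim_two_flag
    (A : Module.End ℝ (Fin 4 → ℝ))
    (hnil : IsNilpotent A) (hA2 : A ^ 2 ≠ 0)
    (hker : Module.finrank ℝ (LinearMap.ker A) = 2) :
    Module.finrank ℝ (LinearMap.range A) = 2 ∧
    LinearMap.ker A ≠ LinearMap.range A ∧
    Module.finrank ℝ (LinearMap.ker A ⊓ LinearMap.range A : Submodule ℝ (Fin 4 → ℝ)) = 1 ∧
    Module.finrank ℝ (LinearMap.ker A ⊔ LinearMap.range A : Submodule ℝ (Fin 4 → ℝ)) = 3 ∧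
    ∀ g : (Fin 4 → ℝ) ≃ₗ[ℝ] (Fin 4 → ℝ),
      (g : Module.End ℝ (Fin 4 → ℝ)) * A = A * (g : Module.End ℝ (Fin 4 → ℝ)) →
      ((∀ x ∈ LinearMap.ker A ⊓ LinearMap.range A, g x ∈ LinearMap.ker A ⊓ LinearMap.range A) ∧
       (∀ x ∈ LinearMap.ker A, g x ∈ LinearMap.ker A) ∧
       (∀ x ∈ LinearMap.ker A ⊔ LinearMap.range A, g x ∈ LinearMap.ker A ⊔ LinearMap.range A)) := by
  have hr : Module.finrank ℝ (LinearMap.range A) = 2 := by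
    have h := LinearMap.finrank_range_add_finrank_ker A
    rw [hker, Module.finrank_fin_fun] at h
    omega
  have hsq : ¬ LinearMap.range A ≤ LinearMap.ker A := by
    intro h
    apply hA2
    refine LinearMap.ext fun x => ?_
    rw [pow_two]
    exact LinearMap.mem_ker.1 (h (LinearMap.mem_range_self A x))
  have hne : LinearMap.ker A ≠ LinearMap.range A := fun h => hsq h.ge
  have hbot : LinearMap.ker A ⊓ LinearMap.range A ≠ ⊥ := by
    intro h
    obtain ⟨n, hn⟩ := hnil
    have key : ∀ k : ℕ, ∀ x, (A ^ (k + 1)) x = 0 → A x = 0 := by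
      intro k
      induction k with
      | zero => intro x hx; simpa using hx
      | succ k ih =>
        intro x hx
        have h1 : A (A x) = 0 := ih (A x) (by
          rw [pow_succ, Module.End.mul_apply] at hx
          exact hx)
        have h2 : A x ∈ LinearMap.ker A ⊓ LinearMap.range A :=
          ⟨LinearMap.mem_ker.2 h1, LinearMap.mem_range_self A x⟩
        rw [h] at h2
        exact (Submodule.mem_bot ℝ).1 h2
    apply hsq
    rintro _ ⟨x, rfl⟩
    have : A x = 0 := key n x (by rw [pow_succ, hn]; simp)
    rw [this]
    exact Submodule.zero_mem _
  have hi : Module.finrank ℝ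
      (LinearMap.ker A ⊓ LinearMap.range A : Submodule ℝ (Fin 4 → ℝ)) = 1 := by
    have h0 := mt Submodule.finrank_eq_zero.1 hbot
    have hlt : LinearMap.ker A ⊓ LinearMap.range A < LinearMap.range A :=
      lt_of_le_of_ne inf_le_right (fun h => hsq (inf_eq_right.1 h))
    have := Submodule.finrank_lt_finrank_of_lt hlt
    omega
  have hs := Submodule.finrank_sup_add_finrank_inf_eq (LinearMap.ker A) (LinearMap.range A)
  refine ⟨hr, hne, hi, by omega, ?_⟩
  intro g hg
  have hc : ∀ x, g (A x) = A (g x) := fun x => LinearMap.congr_fun hg x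
  have hk : ∀ x ∈ LinearMap.ker A, g x ∈ LinearMap.ker A := by
    intro x hx
    rw [LinearMap.mem_ker] at hx ⊢
    rw [← hc, hx, map_zero]
  have hra : ∀ x ∈ LinearMap.range A, g x ∈ LinearMap.range A := by
    rintro _ ⟨x, rfl⟩
    exact ⟨g x, (hc x).symm⟩
  refine ⟨fun x hx => ⟨hk x hx.1, hra x hx.2⟩, hk, ?_⟩
  intro x hx
  obtain ⟨y, hy, z, hz, rfl⟩ := Submodule.mem_sup.1 hx
  rw [map_add]
  exact Submodule.add_mem_sup (hk y hy) (hra z hz)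
end

section
/- Let 𝒩 be a non-unital subalgebra of the algebra of linear endomorphisms of the real vector space ℝ⁴ (i.e. a subspace closed under composition) such that every element of 𝒩 is nilpotent, and suppose 𝒩 is not commutative (there exist A, B ∈ 𝒩 with A∘B ≠ B∘A). Then every subgroup G of the group of linear automorphisms of ℝ⁴, all of whose elements commute with every element of 𝒩, is solvable. -/
abbrev V4 := Fin 4 → ℝ

lemma solv_of_chain (G : Subgroup (V4 ≃ₗ[ℝ] V4)) (F : ℕ → Submodule ℝ V4)
    (hmono : Monotone F) (h0 : F 0 = ⊥) (n : ℕ) (hn : F n = ⊤)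
    (hpres : ∀ g ∈ G, ∀ i, ∀ v ∈ F i, g v ∈ F i)
    (hD : ∀ g ∈ G, ∀ h ∈ G, ∀ i, ∀ v ∈ F (i+1), g (h v) - h (g v) ∈ F i) :
    IsSolvable G := by
  have key : ∀ (g h : G) (v : V4), (g * h * g⁻¹ * h⁻¹).1 v - v =
      g.1 (h.1 (g⁻¹.1 (h⁻¹.1 v))) - h.1 (g.1 (g⁻¹.1 (h⁻¹.1 v))) := by
    intro g h v
    have e1 : ∀ (g : G) (x : V4), g.1 (g⁻¹.1 x) = x := fun g x => by
      simpa using g.1.apply_symm_apply x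
    rw [e1 g, e1 h]
    rfl
  let P : ℕ → Subgroup G := fun k =>
    { carrier := {g | ∀ i, ∀ v ∈ F (i + k), g.1 v - v ∈ F i}
      one_mem' := by intro i v _; simp
      mul_mem' := by
        intro a b ha hb i v hv
        have h1 := hb i v hv
        have h2 := ha i v hv
        have h3 := hpres a.1 a.2 i _ h1
        have : (a * b).1 v - v = a.1 (b.1 v - v) + (a.1 v - v) := by
          simp
        rw [this]
        exact add_mem h3 h2
      inv_mem' := by
        intro a ha i v hv
        have h2 := ha i v hv
        have h3 := hpres a⁻¹.1 a⁻¹.2 i _ h2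
        have e1 : a⁻¹.1 (a.1 v) = v := by simpa using a.1.symm_apply_apply v
        rw [map_sub, e1] at h3
        simpa using neg_mem h3 }
  have hP : ∀ k, derivedSeries G (k+1) ≤ P (k+1) := by
    intro k
    induction k with
    | zero =>
      rw [derivedSeries_succ, Subgroup.commutator_le]
      intro g _ h _ i v hv
      rw [commutatorElement_def, key]
      exact hD g.1 g.2 h.1 h.2 i _ (hpres _ g⁻¹.2 _ _ (hpres _ h⁻¹.2 _ _ hv))
    | succ k ih =>
      rw [derivedSeries_succ, Subgroup.commutator_le]
      intro g hg h hh i v hv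
      rw [commutatorElement_def, key]
      have hw := hpres _ g⁻¹.2 _ _ (hpres _ h⁻¹.2 _ _ hv)
      generalize g⁻¹.1 (h⁻¹.1 v) = w at hw
      have hg' := ih hg
      have hh' := ih hh
      have hw' : w ∈ F ((i + (k+1)) + (k+1)) := hmono (by omega) hw
      have a1 := hg' i _ (hh' _ w hw')
      have a2 := hh' i _ (hg' _ w hw')
      have : g.1 (h.1 w) - h.1 (g.1 w) =
        (g.1 (h.1 w - w) - (h.1 w - w)) - (h.1 (g.1 w - w) - (g.1 w - w)) := by
        simp only [map_sub]; abel
      rw [this]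
      exact sub_mem a1 a2
  refine ⟨n+1, ?_⟩
  rw [eq_bot_iff]
  intro g hg
  have h := hP n hg
  rw [Subgroup.mem_bot]
  ext1
  ext1 v
  have := h 0 v (hmono (by omega : n ≤ 0 + (n+1)) (by rw [hn]; trivial))
  rw [h0, Submodule.mem_bot, sub_eq_zero] at this
  exact this

lemma span4 {v : Fin 4 → V4} (hv : LinearIndependent ℝ v) (x : V4) :
    ∃ a b c d : ℝ, x = a • v 0 + b • v 1 + c • v 2 + d • v 3 := by
  let B := basisOfLinearIndependentOfCardEqFinrank hv (by simp)
  refine ⟨B.repr x 0, B.repr x 1, B.repr x 2, B.repr x 3, ?_⟩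
  have := B.sum_repr x
  rw [Fin.sum_univ_four] at this
  simpa [B] using this.symm

lemma li4 {a b c d : V4} (h : ∀ p q r s : ℝ, p • a + q • b + r • c + s • d = 0 →
    p = 0 ∧ q = 0 ∧ r = 0 ∧ s = 0) : LinearIndependent ℝ ![a, b, c, d] := by
  rw [Fintype.linearIndependent_iff]
  intro g hg
  rw [Fin.sum_univ_four] at hg
  have := h _ _ _ _ hg
  intro i
  fin_cases i <;> simp [this]

/-- cyclic case with exterior algebra -/
lemma case_ext (A B : Module.End ℝ V4) (hA : ∀ x, A (A x) = 0) (hB : ∀ x, B (B x) = 0)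
    (hAB : ∀ x, B (A x) = - A (B x)) (v : V4) (hv : A (B v) ≠ 0)
    (G : Subgroup (V4 ≃ₗ[ℝ] V4)) (hGA : ∀ g ∈ G, ∀ x, g (A x) = A (g x))
    (hGB : ∀ g ∈ G, ∀ x, g (B x) = B (g x)) : IsSolvable G := by
  have li : LinearIndependent ℝ ![v, A v, B v, A (B v)] := by
    apply li4
    intro p q r s h
    have h1 := congrArg (fun x => A (B x)) h
    simp [hA, hB, hAB, hv] at h1
    subst h1
    have h2 := congrArg A h
    have h3 := congrArg B h
    simp [hA, hB, hAB, hv] at h2 h3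
    subst h2; subst h3
    simpa [hv] using h
  have sp : ∀ x : V4, ∃ a b c d : ℝ, x = a • v + b • A v + c • B v + d • A (B v) := span4 li
  have hR : ∀ g ∈ G, ∀ x, g (A (B x)) = A (B (g x)) := fun g hg x => by
    rw [hGA g hg, hGB g hg]
  have hABAB : ∀ x, A (B (A (B x))) = 0 := fun x => by simp [hAB, hB]
  let F : ℕ → Submodule ℝ V4 := fun
    | 0 => ⊥
    | 1 => LinearMap.range (A * B)
    | _ => ⊤
  have hcom : ∀ g ∈ G, ∀ h ∈ G, ∀ x, ∃ t : ℝ, g (h x) - h (g x) = t • A (B x) := by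
    intro g hg h hh x
    obtain ⟨a, b, c, d, e⟩ := sp (g v)
    obtain ⟨a', b', c', d', e'⟩ := sp (h v)
    obtain ⟨p, q, r, s, rfl⟩ := sp x
    refine ⟨2 * (b' * c - c' * b), ?_⟩
    simp only [map_add, map_smul, map_neg, smul_neg, smul_zero, neg_zero, map_zero, hGA g hg,
      hGB g hg, hGA h hh, hGB h hh, e, e', hA, hB, hAB]
    module
  refine solv_of_chain G F (monotone_nat_of_le_succ ?_) rfl 2 rfl ?_ ?_
  · rintro (_ | _ | i) <;> simp [F]
  · rintro g hg (_ | _ | i) x hx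
    · simp only [F, Submodule.mem_bot] at hx ⊢; simp [hx]
    · obtain ⟨y, rfl⟩ := hx
      exact ⟨g y, (hR g hg y).symm⟩
    · trivial
  · rintro g hg h hh (_ | _ | i) x hx
    · obtain ⟨y, rfl⟩ := hx
      obtain ⟨t, ht⟩ := hcom g hg h hh ((A * B) y)
      rw [ht]
      simp [hABAB, F]
    · obtain ⟨t, ht⟩ := hcom g hg h hh x
      rw [ht]
      exact ⟨t • x, by simp⟩
    · trivial

lemma case_J4 (X : Module.End ℝ V4) (hX : ∀ x, X (X (X (X x))) = 0) (v : V4)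
    (hv : X (X (X v)) ≠ 0)
    (G : Subgroup (V4 ≃ₗ[ℝ] V4)) (hG : ∀ g ∈ G, ∀ x, g (X x) = X (g x)) : IsSolvable G := by
  have li : LinearIndependent ℝ ![v, X v, X (X v), X (X (X v))] := by
    apply li4
    intro p q r s h
    have h1 := congrArg (fun x => X (X (X x))) h
    simp [hX, hv] at h1
    subst h1
    have h1 := congrArg (fun x => X (X x)) h
    simp [hX, hv] at h1
    subst h1
    have h1 := congrArg (fun x => X x) h
    simp [hX, hv] at h1
    subst h1
    simpa [hv] using h
  have sp : ∀ x : V4, ∃ a b c d : ℝ, x = a • v + b • X v + c • X (X v) + d • X (X (X v)) :=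
    span4 li
  have form : ∀ g ∈ G, ∃ a b c d : ℝ, ∀ x,
      g x = a • x + b • X x + c • X (X x) + d • X (X (X x)) := by
    intro g hg
    obtain ⟨a, b, c, d, h⟩ := sp (g v)
    refine ⟨a, b, c, d, fun x => ?_⟩
    obtain ⟨p, q, r, s, rfl⟩ := sp x
    simp only [map_add, map_smul, smul_zero, map_zero, hG g hg, h, hX]
    module
  have hcom : ∀ g ∈ G, ∀ h ∈ G, ∀ x, g (h x) - h (g x) = 0 := by
    intro g hg h hh x
    obtain ⟨a, b, c, d, e⟩ := form g hg
    obtain ⟨a', b', c', d', e'⟩ := form h hh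
    simp only [map_add, map_smul, smul_zero, map_zero, e, e', hX]
    module
  let F : ℕ → Submodule ℝ V4 := fun
    | 0 => ⊥
    | _ => ⊤
  refine solv_of_chain G F (monotone_nat_of_le_succ ?_) rfl 1 rfl ?_ ?_
  · rintro (_ | i) <;> simp [F]
  · rintro g hg (_ | i) x hx
    · simp only [F, Submodule.mem_bot] at hx ⊢; simp [hx]
    · trivial
  · rintro g hg h hh i x hx
    rw [hcom g hg h hh]
    exact zero_mem _

lemma case_J3 (X : Module.End ℝ V4) (hX : ∀ x, X (X (X x)) = 0) (v : V4)
    (hv : X (X v) ≠ 0)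
    (G : Subgroup (V4 ≃ₗ[ℝ] V4)) (hG : ∀ g ∈ G, ∀ x, g (X x) = X (g x)) : IsSolvable G := by
  have hw : ∃ w, w ∉ Submodule.span ℝ (Set.range ![v, X v, X (X v)]) := by
    by_contra! hcon
    have h1 : Submodule.span ℝ (Set.range ![v, X v, X (X v)]) = ⊤ := by
      rw [eq_top_iff]; intro w _; exact hcon w
    have h2 := finrank_range_le_card (R := ℝ) ![v, X v, X (X v)]
    rw [Set.finrank, h1] at h2
    simp at h2
  have hU : ∀ a b c : ℝ, a • v + b • X v + c • X (X v) ∈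
      Submodule.span ℝ (Set.range ![v, X v, X (X v)]) := by
    intro a b c
    refine add_mem (add_mem ?_ ?_) ?_ <;> refine Submodule.smul_mem _ _ (Submodule.subset_span ?_)
    · exact ⟨0, rfl⟩
    · exact ⟨1, rfl⟩
    · exact ⟨2, rfl⟩
  have LI : ∀ w, w ∉ Submodule.span ℝ (Set.range ![v, X v, X (X v)]) →
      LinearIndependent ℝ ![v, X v, X (X v), w] := by
    intro w hw
    apply li4
    intro p q r s h
    have hs : s = 0 := by
      by_contra hs
      apply hw
      have : w = (-s⁻¹) • (p • v + q • X v + r • X (X v)) := by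
        have h' : p • v + q • X v + r • X (X v) = - (s • w) := by
          rw [eq_neg_iff_add_eq_zero]; exact h
        rw [h', smul_neg, neg_smul, neg_neg, smul_smul, inv_mul_cancel₀ hs, one_smul]
      rw [this]
      exact Submodule.smul_mem _ _ (hU _ _ _)
    subst hs
    have h1 := congrArg (fun x => X (X x)) h
    simp [hX, hv] at h1
    subst h1
    have h1 := congrArg (fun x => X x) h
    simp [hX, hv] at h1
    subst h1
    simpa [hv] using h
  have hw' : ∃ w, w ∉ Submodule.span ℝ (Set.range ![v, X v, X (X v)]) ∧ X w = 0 := by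
    obtain ⟨w, hw⟩ := hw
    obtain ⟨a, b, c, d, h⟩ : ∃ a b c d : ℝ, X w = a • v + b • X v + c • X (X v) + d • w :=
      span4 (LI w hw) _
    have hw0 : w ≠ 0 := by rintro rfl; exact hw (zero_mem _)
    have hd : d = 0 := by
      by_contra hd
      apply hw
      have e := hX w
      have e2 : X (X w) = (d*a) • v + (a + d * b) • X v + (b + d * c) • X (X v) + (d*d) • w := by
        conv_lhs => rw [h]
        simp only [map_add, map_smul, hX, h]
        module
      rw [e2] at e
      simp only [map_add, map_smul, hX, h] at e
      have : w = (-(d*d*d)⁻¹) • ((d*d*a) • v + (d*a+d*d*b) • X v + (a+d*b+d*d*c) • X (X v)) := by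
        have h' : ((d*d*a) • v + (d*a+d*d*b) • X v + (a+d*b+d*d*c) • X (X v))
            = - ((d*d*d) • w) := by
          rw [eq_neg_iff_add_eq_zero, ← e]; module
        rw [h', smul_neg, neg_smul, neg_neg, smul_smul, inv_mul_cancel₀ (by simp [hd]), one_smul]
      rw [this]
      exact Submodule.smul_mem _ _ (hU _ _ _)
    subst hd
    have ha : a = 0 := by
      have e := hX w
      rw [h] at e
      simpa [hX, hv] using e
    subst ha
    refine ⟨w - (b • v + c • X v), fun hc => hw ?_, ?_⟩
    · have := add_mem hc (hU b c 0)
      simpa using this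
    · simp [h]
  clear hw
  obtain ⟨w, hw, hXw⟩ := hw'
  have li := LI w hw
  have sp : ∀ x : V4, ∃ a b c d : ℝ, x = a • v + b • X v + c • X (X v) + d • w := span4 li
  have form : ∀ g ∈ G, ∃ a b c d e f : ℝ, g v = a • v + b • X v + c • X (X v) + d • w ∧
      g w = e • X (X v) + f • w := by
    intro g hg
    obtain ⟨a, b, c, d, h⟩ := sp (g v)
    obtain ⟨p, q, r, s, h'⟩ := sp (g w)
    have h1 : X (g w) = 0 := by rw [← hG g hg, hXw, map_zero]
    have h2 := h1
    rw [h'] at h2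
    have h3 := congrArg X h2
    simp [hX, hXw, hv] at h3
    subst h3
    simp [hX, hXw, hv] at h2
    subst h2
    exact ⟨a, b, c, d, r, s, h, by rw [h']; simp⟩
  have hcom : ∀ g ∈ G, ∀ h ∈ G, ∃ p q r s : ℝ,
      g (h v) - h (g v) = p • X v + q • X (X v) + r • w ∧ 
      g (h w) - h (g w) = s • X (X v) := by
    intro g hg h hh
    obtain ⟨a, b, c, d, e, f, h1, h2⟩ := form g hg
    obtain ⟨a', b', c', d', e', f', h1', h2'⟩ := form h hh
    refine ⟨0, d' * e - d * e', a' * d + d' * f - a * d' - d * f',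
      e' * a + f' * e - e * a' - f * e', ?_, ?_⟩
    · simp only [map_add, map_smul, smul_zero, map_zero, hG g hg, hG h hh, h1, h2, h1', h2', hX, hXw]
      module
    · simp only [map_add, map_smul, smul_zero, map_zero, hG g hg, hG h hh, h1, h2, h1', h2', hX, hXw]
      module
  let F : ℕ → Submodule ℝ V4 := fun
    | 0 => ⊥
    | 1 => LinearMap.range (X * X)
    | 2 => LinearMap.ker (X * X)
    | _ => ⊤
  refine solv_of_chain G F (monotone_nat_of_le_succ ?_) rfl 3 rfl ?_ ?_
  · rintro (_ | _ | _ | i)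
    · simp [F]
    · rintro _ ⟨y, rfl⟩
      simp [F, hX]
    · simp [F]
    · simp [F]
  · rintro g hg (_ | _ | _ | i) x hx
    · simp only [F, Submodule.mem_bot] at hx ⊢; simp [hx]
    · obtain ⟨y, rfl⟩ := hx
      exact ⟨g y, by simp [hG g hg]⟩
    · have hx' : X (X x) = 0 := hx
      change X (X (g x)) = 0
      rw [← hG g hg, ← hG g hg, hx', map_zero]
    · trivial
  · rintro g hg h hh i x hx
    obtain ⟨p, q, r, s, h1, h2⟩ := hcom g hg h hh
    have hD : ∀ a b c d : ℝ, x = a • v + b • X v + c • X (X v) + d • w →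
        g (h x) - h (g x) = a • (p • X v + q • X (X v) + r • w) + (b * p + d * s) • X (X v) := by
      rintro a b c d rfl
      have e1 : g (h (X v)) - h (g (X v)) = p • X (X v) := by
        rw [hG g hg, hG h hh, hG g hg, hG h hh, ← map_sub, h1]
        simp [hX, hXw]
      have e2 : g (h (X (X v))) - h (g (X (X v))) = 0 := by
        simp only [hG g hg, hG h hh]
        rw [← map_sub, ← map_sub, h1]
        simp [hX, hXw]
      rw [← h1]
      calc _ = a • (g (h v) - h (g v)) + b • (g (h (X v)) - h (g (X v)))
            + c • (g (h (X (X v))) - h (g (X (X v)))) + d • (g (h w) - h (g w)) := by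
              simp only [map_add, map_smul]; module
        _ = _ := by rw [e1, e2, h2]; module
    obtain ⟨a, b, c, d, hx1⟩ := sp x
    have hDx := hD _ _ _ _ hx1
    rcases i with _ | _ | i
    · obtain ⟨y, rfl⟩ := hx
      obtain ⟨a', b', c', d', rfl⟩ := sp y
      have := hD 0 0 a' 0 (by simp [hX, hXw])
      rw [this]
      simp
    · have hx' : X (X x) = 0 := hx
      have ha : a = 0 := by
        rw [hx1] at hx'
        simpa [hX, hXw, hv] using hx'
      subst ha
      rw [hDx]
      exact ⟨(b * p + d * s) • v, by simp⟩
    · rcases i with _ | i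
      · rw [hDx]
        change X (X _) = 0
        simp [hX, hXw]
      · trivial

/-- A noncommutative algebra of nilpotent endomorphisms of `ℝ⁴` forces every group of
automorphisms commuting with it to be solvable. -/
theorem centralizer_of_noncommutative_nilpotent_algebra_solvable
    (𝒩 : NonUnitalSubalgebra ℝ (Module.End ℝ (Fin 4 → ℝ)))
    (hnil : ∀ A ∈ 𝒩, IsNilpotent A)
    (hnc : ∃ A ∈ 𝒩, ∃ B ∈ 𝒩, A * B ≠ B * A)
    (G : Subgroup ((Fin 4 → ℝ) ≃ₗ[ℝ] (Fin 4 → ℝ)))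
    (hcomm : ∀ g ∈ G, ∀ A ∈ 𝒩,
      (g : Module.End ℝ (Fin 4 → ℝ)) * A = A * (g : Module.End ℝ (Fin 4 → ℝ))) :
    IsSolvable G := by
  have hc : ∀ A ∈ 𝒩, ∀ g ∈ G, ∀ x, g (A x) = A (g x) := fun A hA g hg x =>
    LinearMap.congr_fun (hcomm g hg A hA) x
  by_cases hsq : ∃ X ∈ 𝒩, ∃ v, X (X v) ≠ 0
  · obtain ⟨X, hX, v, hv⟩ := hsq
    have h4 : X ^ 4 = 0 := by
      have h1 := (LinearMap.charpoly_eq_X_pow_iff X).2 (fun m => by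
        obtain ⟨n, hn⟩ := hnil X hX
        exact ⟨n, by simp [hn]⟩)
      have h2 := LinearMap.aeval_self_charpoly X
      rw [h1] at h2
      simpa using h2
    have h4' : ∀ x, X (X (X (X x))) = 0 := fun x => by
      have := LinearMap.congr_fun h4 x
      simpa [pow_succ] using this
    by_cases h3 : ∃ u, X (X (X u)) ≠ 0
    · obtain ⟨u, hu⟩ := h3
      exact case_J4 X h4' u hu G (hc X hX)
    · push Not at h3
      exact case_J3 X h3 v hv G (hc X hX)
  · push Not at hsq
    obtain ⟨A, hA, B, hB, hAB⟩ := hnc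
    have hanti : ∀ x, B (A x) = - A (B x) := by
      intro x
      have := hsq (A + B) (add_mem hA hB) x
      simp [hsq A hA, hsq B hB] at this
      rw [eq_neg_iff_add_eq_zero]
      rw [← this]; abel
    have : ∃ v, A (B v) ≠ 0 := by
      by_contra! hcon
      apply hAB
      refine LinearMap.ext fun x => ?_
      simp only [Module.End.mul_apply, hanti, hcon, neg_zero]
    obtain ⟨v, hv⟩ := this
    exact case_ext A B (hsq A hA) (hsq B hB) hanti v hv G (hc A hA) (hc B hB)
end
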